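/- arXiv:1712.03103 — 4 statements merged into one kernel-verified Lean document; each statement's English description precedes it below -/
import Mathlib

section
/- Let V be a complex vector space, L : V → V a linear map, p₀, p₁ : V → ℝ nonnegative functions, θ ∈ (0,1), A₀ ≥ 1, b > 1 a real number and n₀ ≥ 1 an integer; set ‖h‖_b = p₀(h) + p₁(h)/b. Assume: (i) p₀(L h) ≤ p₀(h) for all h ∈ V; (ii) p₁(L^ℓ h) ≤ A₀·(θ^ℓ·p₁(h) + b·p₀(h)) for every integer ℓ ≥ 0 and all h ∈ V; (iii) ‖L^{n₀} h‖_b ≤ (1/b)·‖h‖_b for all h ∈ V. Then for every integer n ≥ n₀ and every h ∈ V, ‖L^n h‖_b ≤ 3·A₀·b^{−n/(2n₀)}·‖h‖_b. -/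
/-- The bootstrap argument (8.1) of Section 8: the sup-norm contraction (i), the
Lasota–Yorke inequality (ii) and one single-time estimate (iii) for the norm
`‖h‖_b = p₀(h) + p₁(h)/b` upgrade to exponential decay
`‖L^n h‖_b ≤ 3 A₀ b^{-n/(2n₀)} ‖h‖_b` for all `n ≥ n₀`. -/
theorem stmt10 {V : Type*} [AddCommGroup V] [Module ℂ V]
    (L : V →ₗ[ℂ] V) (p₀ p₁ : V → ℝ)
    (hp₀ : ∀ h : V, 0 ≤ p₀ h) (hp₁ : ∀ h : V, 0 ≤ p₁ h)
    (θ A₀ b : ℝ) (hθ0 : 0 < θ) (hθ1 : θ < 1) (hA₀ : 1 ≤ A₀) (hb : 1 < b)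
    (n₀ : ℕ) (hn₀ : 1 ≤ n₀)
    (h1 : ∀ h : V, p₀ (L h) ≤ p₀ h)
    (h2 : ∀ (ℓ : ℕ) (h : V), p₁ ((L ^ ℓ) h) ≤ A₀ * (θ ^ ℓ * p₁ h + b * p₀ h))
    (h3 : ∀ h : V, p₀ ((L ^ n₀) h) + p₁ ((L ^ n₀) h) / b ≤ (1 / b) * (p₀ h + p₁ h / b)) :
    ∀ n : ℕ, n₀ ≤ n → ∀ h : V,
      p₀ ((L ^ n) h) + p₁ ((L ^ n) h) / b
        ≤ 3 * A₀ * b ^ (-(n : ℝ) / (2 * (n₀ : ℝ))) * (p₀ h + p₁ h / b) := by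
  have hb0 : 0 < b := by linarith
  have h1' : ∀ (k : ℕ) (h : V), p₀ ((L ^ k) h) ≤ p₀ h := by
    intro k
    induction k with
    | zero => intro h; simp
    | succ k ih =>
      intro h
      rw [pow_succ, Module.End.mul_apply]
      exact (ih (L h)).trans (h1 h)
  have hstep : ∀ (r : ℕ) (g : V),
      p₀ ((L ^ r) g) + p₁ ((L ^ r) g) / b ≤ 3 * A₀ * (p₀ g + p₁ g / b) := by
    intro r g
    have hθ : θ ^ r ≤ 1 := pow_le_one₀ hθ0.le hθ1.le
    have hle : p₁ ((L ^ r) g) / b ≤ A₀ * (p₁ g / b + p₀ g) := by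
      rw [div_le_iff₀ hb0]
      calc p₁ ((L ^ r) g) ≤ A₀ * (θ ^ r * p₁ g + b * p₀ g) := h2 r g
        _ ≤ A₀ * (1 * p₁ g + b * p₀ g) := by
          have := hp₁ g
          gcongr
        _ = A₀ * (p₁ g / b + p₀ g) * b := by field_simp
    have hq : 0 ≤ p₁ g / b := div_nonneg (hp₁ g) hb0.le
    nlinarith [h1' r g, hp₀ g, mul_nonneg (sub_nonneg.2 hA₀) (hp₀ g),
      mul_nonneg (sub_nonneg.2 hA₀) hq]
  have hiter : ∀ (q : ℕ) (h : V),
      p₀ ((L ^ (n₀ * q)) h) + p₁ ((L ^ (n₀ * q)) h) / b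
        ≤ (1 / b) ^ q * (p₀ h + p₁ h / b) := by
    intro q
    induction q with
    | zero => intro h; simp
    | succ q ih =>
      intro h
      rw [Nat.mul_succ, pow_add, Module.End.mul_apply, pow_succ, mul_assoc]
      exact (ih _).trans (mul_le_mul_of_nonneg_left (h3 h) (by positivity))
  intro n hn h
  have hN : 0 ≤ p₀ h + p₁ h / b := add_nonneg (hp₀ h) (div_nonneg (hp₁ h) hb0.le)
  have hq1 : 1 ≤ n / n₀ := (Nat.one_le_div_iff hn₀).2 hn
  have hpow : (1 / b) ^ (n / n₀) ≤ b ^ (-(n : ℝ) / (2 * (n₀ : ℝ))) := by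
    rw [one_div, inv_pow, ← Real.rpow_natCast, ← Real.rpow_neg hb0.le]
    apply Real.rpow_le_rpow_of_exponent_le hb.le
    have hlt : n % n₀ < n₀ := Nat.mod_lt _ hn₀
    have hle : n ≤ 2 * n₀ * (n / n₀) := by nlinarith [Nat.div_add_mod n n₀]
    have hle' : (n : ℝ) ≤ 2 * n₀ * ((n / n₀ : ℕ) : ℝ) := by exact_mod_cast hle
    have hpos : (0 : ℝ) < 2 * n₀ := by
      have : (0 : ℝ) < n₀ := by exact_mod_cast hn₀
      linarith
    rw [le_div_iff₀ hpos]
    linarith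
  have hsplit : (L ^ n) h = (L ^ (n % n₀)) ((L ^ (n₀ * (n / n₀))) h) := by
    rw [← Module.End.mul_apply, ← pow_add, Nat.mod_add_div]
  rw [hsplit, mul_assoc]
  refine (hstep _ _).trans (mul_le_mul_of_nonneg_left ?_ (by positivity))
  exact (hiter _ h).trans (mul_le_mul_of_nonneg_right hpow hN)
end

section
/- Let E be a real normed vector space, p ≥ 1 an integer, β ∈ (0,1], D ≥ 0, and μ, ν > 0 with ν < μ^{1+β}. Let ψ₀,…,ψ_{p−1} : E → E be maps and A₀,…,A_{p−1} : E → E linear maps such that ‖ψ_k(x) − ψ_k(y) − A_k(x − y)‖ ≤ D·(‖x − y‖^{1+β} + ‖y‖^β·‖x − y‖) for every k and all x, y ∈ E. Let v₀,…,v_p and η₀,…,η_p in E satisfy v_{k+1} = ψ_k(v_k) and η_{k+1} = ψ_k(η_k) for 0 ≤ k < p, and assume: (a) ‖v_k − η_k‖ ≤ μ^{−(p−k)}·‖v_p − η_p‖ and ‖η_k‖ ≤ μ^{−(p−k)}·‖η_p‖ for 0 ≤ k ≤ p; (b) ‖(A_{p−1}∘⋯∘A_j)(u)‖ ≤ ν^{p−j}·‖u‖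 for every 0 ≤ j ≤ p and u ∈ E (the empty composition being the identity). Then ‖(v_p − η_p) − (A_{p−1}∘⋯∘A₀)(v₀ − η₀)‖ ≤ (D/(μ^{1+β} − ν))·( ‖v_p − η_p‖^{1+β} + ‖η_p‖^β·‖v_p − η_p‖ ). -/
/-- The composition `A_{j+n-1} ∘ ⋯ ∘ A_j` of a sequence of linear maps
(the empty composition being the identity). -/
def compSeq {E : Type*} [AddCommGroup E] [Module ℝ E]
    (A : ℕ → (E →ₗ[ℝ] E)) (j : ℕ) : ℕ → (E →ₗ[ℝ] E)
  | 0 => LinearMap.id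
  | n + 1 => (A (j + n)).comp (compSeq A j n)

theorem compSeq_succ_eq_comp {E : Type*} [AddCommGroup E] [Module ℝ E]
    (A : ℕ → (E →ₗ[ℝ] E)) (j n : ℕ) :
    compSeq A j (n + 1) = (compSeq A (j + 1) n).comp (A j) := by
  induction n with
  | zero => simp [compSeq]
  | succ n ih =>
    rw [compSeq, ih, compSeq, LinearMap.comp_assoc, show j + (n + 1) = j + 1 + n by omega]

/-- If both arguments contract by the factor `c`, the remainder bound
`x ^ (1 + β) + y ^ β * x` contracts by the factor `c ^ (1 + β)`. -/
theorem rpow_remainder_le {a b x y c β : ℝ} (ha : 0 ≤ a) (hb : 0 ≤ b) (hx : 0 ≤ x)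
    (hy : 0 ≤ y) (hc : 0 < c) (hβ : 0 ≤ β) (hax : a ≤ c * x) (hby : b ≤ c * y) :
    a ^ (1 + β) + b ^ β * a ≤ c ^ (1 + β) * (x ^ (1 + β) + y ^ β * x) := by
  calc a ^ (1 + β) + b ^ β * a
      ≤ (c * x) ^ (1 + β) + (c * y) ^ β * (c * x) := by gcongr
    _ = c ^ (1 + β) * (x ^ (1 + β) + y ^ β * x) := by
      rw [Real.mul_rpow hc.le hx, Real.mul_rpow hc.le hy, Real.rpow_add hc, Real.rpow_one]
      ring

/-- A sequence satisfying an approximate linear recursion stays close to the exact one, when the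
recursion errors decay backwards at a rate `M` exceeding the forward growth rate `ν`. -/
theorem norm_sub_compSeq_le {E : Type*} [NormedAddCommGroup E] [NormedSpace ℝ E]
    (p : ℕ) {K M ν : ℝ} (hν : 0 < ν) (hνM : ν < M) (A : ℕ → (E →ₗ[ℝ] E)) (d : ℕ → E)
    (hd : ∀ j n, j + (n + 1) = p → ‖d (j + 1) - A j (d j)‖ ≤ K * (M ^ (n + 1))⁻¹)
    (hA : ∀ j n, j + n = p → ∀ u : E, ‖compSeq A j n u‖ ≤ ν ^ n * ‖u‖)
    (n j : ℕ) (hj : j + n = p) :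
    ‖d p - compSeq A j n (d j)‖ ≤ K / (M - ν) * (1 - (ν / M) ^ n) := by
  have hM : 0 < M := hν.trans hνM
  induction n generalizing j with
  | zero =>
    obtain rfl : j = p := by omega
    simp [compSeq]
  | succ n ih =>
    have hj' : j + 1 + n = p := by omega
    have hsplit : d p - compSeq A j (n + 1) (d j) =
        (d p - compSeq A (j + 1) n (d (j + 1))) +
          compSeq A (j + 1) n (d (j + 1) - A j (d j)) := by
      rw [compSeq_succ_eq_comp, LinearMap.comp_apply, map_sub]
      abel
    have hMν : M - ν ≠ 0 := (sub_pos.2 hνM).ne'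
    calc ‖d p - compSeq A j (n + 1) (d j)‖
        ≤ ‖d p - compSeq A (j + 1) n (d (j + 1))‖ +
          ‖compSeq A (j + 1) n (d (j + 1) - A j (d j))‖ := hsplit ▸ norm_add_le _ _
      _ ≤ K / (M - ν) * (1 - (ν / M) ^ n) + ν ^ n * (K * (M ^ (n + 1))⁻¹) := by
        refine add_le_add (ih _ hj') ((hA _ _ hj' _).trans ?_)
        gcongr
        exact hd j n hj
      _ = K / (M - ν) * (1 - (ν / M) ^ (n + 1)) := by
        rw [div_pow, div_pow]
        field_simp
        ring

/-- The inductive linearization estimate (10.14) inside Lemma 10.7(b): the difference of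
two orbits of the nonlinear maps `ψ_k` is compared with its linearization along the
derivatives `A_k`, with the explicit constant `D/(μ^{1+β} - ν)`. -/
theorem stmt12 {E : Type*} [NormedAddCommGroup E] [NormedSpace ℝ E]
    (p : ℕ) (hp : 1 ≤ p) (β D μ ν : ℝ) (hβ0 : 0 < β) (hβ1 : β ≤ 1) (hD : 0 ≤ D)
    (hμ : 0 < μ) (hν : 0 < ν) (hνμ : ν < μ ^ (1 + β))
    (ψ : ℕ → E → E) (A : ℕ → (E →ₗ[ℝ] E))
    (hψ : ∀ k < p, ∀ x y : E,
      ‖ψ k x - ψ k y - A k (x - y)‖ ≤ D * (‖x - y‖ ^ (1 + β) + ‖y‖ ^ β * ‖x - y‖))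
    (v η : ℕ → E)
    (hv : ∀ k < p, v (k + 1) = ψ k (v k)) (hη : ∀ k < p, η (k + 1) = ψ k (η k))
    (ha1 : ∀ k ≤ p, ‖v k - η k‖ ≤ (μ ^ (p - k))⁻¹ * ‖v p - η p‖)
    (ha2 : ∀ k ≤ p, ‖η k‖ ≤ (μ ^ (p - k))⁻¹ * ‖η p‖)
    (hb : ∀ j ≤ p, ∀ u : E, ‖compSeq A j (p - j) u‖ ≤ ν ^ (p - j) * ‖u‖) :
    ‖(v p - η p) - compSeq A 0 p (v 0 - η 0)‖
      ≤ (D / (μ ^ (1 + β) - ν)) * (‖v p - η p‖ ^ (1 + β) + ‖η p‖ ^ β * ‖v p - η p‖) := by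
  set S := ‖v p - η p‖ ^ (1 + β) + ‖η p‖ ^ β * ‖v p - η p‖ with hS
  have hS0 : 0 ≤ S := by positivity
  have hMν : 0 < μ ^ (1 + β) - ν := sub_pos.2 hνμ
  have hM : 0 < μ ^ (1 + β) := hν.trans hνμ
  have herr : ∀ j n, j + (n + 1) = p →
      ‖(v (j + 1) - η (j + 1)) - A j (v j - η j)‖ ≤ D * S * ((μ ^ (1 + β)) ^ (n + 1))⁻¹ := by
    intro j n hj
    have hjp : j < p := by omega
    have hpj : p - j = n + 1 := by omega
    have h1 := ha1 j hjp.le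
    have h2 := ha2 j hjp.le
    rw [hpj] at h1 h2
    have hrem := rpow_remainder_le (norm_nonneg _) (norm_nonneg _) (norm_nonneg _)
      (norm_nonneg _) (inv_pos.2 (pow_pos hμ (n + 1))) hβ0.le h1 h2
    rw [Real.inv_rpow (pow_pos hμ _).le, ← Real.rpow_pow_comm hμ.le, ← hS] at hrem
    rw [hv j hjp, hη j hjp]
    calc ‖ψ j (v j) - ψ j (η j) - A j (v j - η j)‖
        ≤ D * (‖v j - η j‖ ^ (1 + β) + ‖η j‖ ^ β * ‖v j - η j‖) := hψ j hjp _ _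
      _ ≤ D * (((μ ^ (1 + β)) ^ (n + 1))⁻¹ * S) := by gcongr
      _ = D * S * ((μ ^ (1 + β)) ^ (n + 1))⁻¹ := by ring
  have hgrowth : ∀ j n, j + n = p → ∀ u : E, ‖compSeq A j n u‖ ≤ ν ^ n * ‖u‖ := by
    intro j n hj u
    obtain rfl : n = p - j := by omega
    exact hb j (by omega) u
  calc ‖(v p - η p) - compSeq A 0 p (v 0 - η 0)‖
      ≤ D * S / (μ ^ (1 + β) - ν) * (1 - (ν / μ ^ (1 + β)) ^ p) :=
        norm_sub_compSeq_le p hν hνμ A (fun k => v k - η k) herr hgrowth p 0 (zero_add p)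
    _ ≤ D * S / (μ ^ (1 + β) - ν) := by
      refine mul_le_of_le_one_right (by positivity) (sub_le_self _ (by positivity))
    _ = D / (μ ^ (1 + β) - ν) * S := by ring
end

section
/- Let E and F be real normed vector spaces, A : E → F and Q : F → F continuous linear maps, S ⊆ E a linear subspace, N_E : E → ℝ a function and N_F : F → ℝ a seminorm. Let β ∈ (0,1], D ≥ 0, Γ ≥ 1, r > 0 and 0 < μ̂ < μ be constants. Assume: (i) ‖u‖ ≤ N_E(u) for all u ∈ E; (ii) N_F(Q(w)) ≤ Γ·‖w‖ for all w ∈ F; (iii) Q(A(u)) = A(u) and N_F(A(u)) ≤ N_E(u)/μ for every u ∈ S; (iv) ψ : E → F is a map such that for each W ∈ E with ‖W‖ ≤ r there is a continuous linear map Dψ(W) : E → F with ‖ψ(V) − ψ(W) − Dψ(W)(V − W)‖ ≤ D·‖V − W‖^{1+β} for all V with ‖V‖ ≤ r, and with ‖Dψ(W) − A‖ ≤ D·‖W‖^β (operator norm); (v) 3·Γ·D·r^β ≤ 1/μ̂ − 1/μ. Then for all V, W ∈ E with ‖V‖ ≤ r, ‖W‖ ≤ r and V − W ∈ S, one has N_F(Q(ψ(V)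 − ψ(W))) ≤ N_E(V − W)/μ̂. -/
/-- Abstract form of the estimate (10.4) of Lemma 10.1: the nonlinear map `ψ`, close to
the linear map `A` in the `C^{1+β}` sense, contracts differences lying in the invariant
subspace `S` at the slightly worse rate `1/μ̂` in the adapted norms. -/
theorem stmt16 {E F : Type*} [NormedAddCommGroup E] [NormedSpace ℝ E]
    [NormedAddCommGroup F] [NormedSpace ℝ F]
    (Amap : E →L[ℝ] F) (Q : F →L[ℝ] F) (S : Submodule ℝ E)
    (NE : E → ℝ) (NF : Seminorm ℝ F)
    (β D Γ r μ μh : ℝ) (hβ0 : 0 < β) (hβ1 : β ≤ 1) (hD : 0 ≤ D) (hΓ : 1 ≤ Γ)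
    (hr : 0 < r) (hμh : 0 < μh) (hμ : μh < μ)
    (h1 : ∀ u : E, ‖u‖ ≤ NE u)
    (h2 : ∀ w : F, NF (Q w) ≤ Γ * ‖w‖)
    (h3 : ∀ u ∈ S, Q (Amap u) = Amap u ∧ NF (Amap u) ≤ NE u / μ)
    (ψ : E → F)
    (h4 : ∀ W : E, ‖W‖ ≤ r → ∃ DψW : E →L[ℝ] F,
      (∀ V : E, ‖V‖ ≤ r → ‖ψ V - ψ W - DψW (V - W)‖ ≤ D * ‖V - W‖ ^ (1 + β)) ∧
        ‖DψW - Amap‖ ≤ D * ‖W‖ ^ β)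
    (h5 : 3 * Γ * D * r ^ β ≤ 1 / μh - 1 / μ) :
    ∀ V W : E, ‖V‖ ≤ r → ‖W‖ ≤ r → V - W ∈ S →
      NF (Q (ψ V - ψ W)) ≤ NE (V - W) / μh := by
  intro V W hV hW hVW
  obtain ⟨L, hL, hLA⟩ := h4 W hW
  obtain ⟨hQA, hNA⟩ := h3 _ hVW
  have hrβ : 0 ≤ r ^ β := Real.rpow_nonneg hr.le β
  have hx : 0 ≤ ‖V - W‖ := norm_nonneg _
  have hpow : ‖V - W‖ ^ (1 + β) ≤ 2 * r ^ β * ‖V - W‖ := by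
    have hxr : ‖V - W‖ ≤ 2 * r := by linarith [norm_sub_le V W]
    have h2β : (2 : ℝ) ^ β ≤ 2 := by
      simpa using Real.rpow_le_rpow_of_exponent_le one_le_two hβ1
    calc ‖V - W‖ ^ (1 + β) = ‖V - W‖ ^ β * ‖V - W‖ := by
          rw [Real.rpow_add_of_nonneg hx zero_le_one hβ0.le, Real.rpow_one, mul_comm]
      _ ≤ (2 * r) ^ β * ‖V - W‖ := by gcongr
      _ = 2 ^ β * r ^ β * ‖V - W‖ := by rw [Real.mul_rpow zero_le_two hr.le]
      _ ≤ 2 * r ^ β * ‖V - W‖ := by gcongr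
  have hlin : ‖(L - Amap) (V - W)‖ ≤ D * r ^ β * ‖V - W‖ := by
    have hWr : ‖W‖ ^ β ≤ r ^ β := by gcongr
    calc ‖(L - Amap) (V - W)‖ ≤ ‖L - Amap‖ * ‖V - W‖ := (L - Amap).le_opNorm _
      _ ≤ D * r ^ β * ‖V - W‖ := by
          gcongr
          exact hLA.trans (by gcongr)
  have hrem : ‖ψ V - ψ W - Amap (V - W)‖ ≤ 3 * D * r ^ β * ‖V - W‖ := by
    calc ‖ψ V - ψ W - Amap (V - W)‖
        = ‖(ψ V - ψ W - L (V - W)) + (L - Amap) (V - W)‖ := by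
          rw [sub_apply, sub_add_sub_cancel]
      _ ≤ D * (2 * r ^ β * ‖V - W‖) + D * r ^ β * ‖V - W‖ :=
          norm_add_le_of_le ((hL V hV).trans (by gcongr)) hlin
      _ = 3 * D * r ^ β * ‖V - W‖ := by ring
  calc NF (Q (ψ V - ψ W))
      = NF (Amap (V - W) + Q (ψ V - ψ W - Amap (V - W))) := by
        rw [map_sub Q _ (Amap (V - W)), hQA, add_sub_cancel]
    _ ≤ NF (Amap (V - W)) + NF (Q (ψ V - ψ W - Amap (V - W))) := map_add_le_add NF _ _
    _ ≤ NE (V - W) / μ + Γ * (3 * D * r ^ β * ‖V - W‖) :=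
        add_le_add hNA ((h2 _).trans (by gcongr))
    _ = NE (V - W) / μ + 3 * Γ * D * r ^ β * ‖V - W‖ := by ring
    _ ≤ NE (V - W) / μ + (1 / μh - 1 / μ) * NE (V - W) := by
        have hgap : 0 ≤ 1 / μh - 1 / μ := le_trans (by positivity) h5
        gcongr
        exact h1 _
    _ = NE (V - W) / μh := by ring
end

section
/- Let E and F be real normed vector spaces, A : E → F and P : F → F continuous linear maps, S ⊆ E a linear subspace, N_E : E → ℝ a function and N_F : F → ℝ a seminorm. Let β ∈ (0,1], D ≥ 0, Γ ≥ 1, r > 0 and 0 < ν < ν̂ be constants. Assume: (i) ‖u‖ ≤ N_E(u) for all u ∈ E; (ii) N_F(P(w)) ≤ Γ·‖w‖ for all w ∈ F; (iii) P(A(u)) = A(u) and N_F(A(u)) ≥ N_E(u)/ν for every u ∈ S; (iv) ψ : E → F is a map such that for each W ∈ E with ‖W‖ ≤ r there is a continuous linear map Dψ(W) : E → F with ‖ψ(V) − ψ(W) − Dψ(W)(V − W)‖ ≤ D·‖V − W‖^{1+β} for all V with ‖V‖ ≤ r, and with ‖Dψ(W) − A‖ ≤ D·‖W‖^β (operator norm);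 (v) 3·Γ·D·r^β ≤ 1/ν − 1/ν̂. Then for all V, W ∈ E with ‖V‖ ≤ r, ‖W‖ ≤ r and V − W ∈ S, one has N_F(P(ψ(V) − ψ(W))) ≥ N_E(V − W)/ν̂. -/
/-- Abstract form of the estimate (10.5) of Lemma 10.1: the nonlinear map `ψ`, close to
the linear map `A` in the `C^{1+β}` sense, expands differences lying in the invariant
subspace `S` at the slightly worse rate `1/ν̂` in the adapted norms. -/
theorem stmt17 {E F : Type*} [NormedAddCommGroup E] [NormedSpace ℝ E]
    [NormedAddCommGroup F] [NormedSpace ℝ F]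
    (Amap : E →L[ℝ] F) (P : F →L[ℝ] F) (S : Submodule ℝ E)
    (NE : E → ℝ) (NF : Seminorm ℝ F)
    (β D Γ r ν νh : ℝ) (hβ0 : 0 < β) (hβ1 : β ≤ 1) (hD : 0 ≤ D) (hΓ : 1 ≤ Γ)
    (hr : 0 < r) (hν : 0 < ν) (hνh : ν < νh)
    (h1 : ∀ u : E, ‖u‖ ≤ NE u)
    (h2 : ∀ w : F, NF (P w) ≤ Γ * ‖w‖)
    (h3 : ∀ u ∈ S, P (Amap u) = Amap u ∧ NE u / ν ≤ NF (Amap u))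
    (ψ : E → F)
    (h4 : ∀ W : E, ‖W‖ ≤ r → ∃ DψW : E →L[ℝ] F,
      (∀ V : E, ‖V‖ ≤ r → ‖ψ V - ψ W - DψW (V - W)‖ ≤ D * ‖V - W‖ ^ (1 + β)) ∧
        ‖DψW - Amap‖ ≤ D * ‖W‖ ^ β)
    (h5 : 3 * Γ * D * r ^ β ≤ 1 / ν - 1 / νh) :
    ∀ V W : E, ‖V‖ ≤ r → ‖W‖ ≤ r → V - W ∈ S →
      NE (V - W) / νh ≤ NF (P (ψ V - ψ W)) := by
  intro V W hV hW hS
  obtain ⟨T, hT, hTA⟩ := h4 W hW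
  obtain ⟨hPA, hexp⟩ := h3 _ hS
  set u := V - W
  set R := ψ V - ψ W - Amap u with hR
  have hu0 : 0 ≤ ‖u‖ := norm_nonneg u
  have hrβ : 0 ≤ r ^ β := Real.rpow_nonneg hr.le β
  have hu2 : ‖u‖ ≤ 2 * r := (norm_sub_le V W).trans (by linarith)
  have hpow : ‖u‖ ^ β ≤ 2 * r ^ β := calc
    ‖u‖ ^ β ≤ (2 * r) ^ β := Real.rpow_le_rpow hu0 hu2 hβ0.le
    _ = 2 ^ β * r ^ β := Real.mul_rpow (by norm_num) hr.le
    _ ≤ 2 * r ^ β := by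
      gcongr
      exact Real.rpow_le_self_of_one_le (by norm_num) hβ1
  have htaylor : ‖ψ V - ψ W - T u‖ ≤ D * (2 * r ^ β) * ‖u‖ := calc
    ‖ψ V - ψ W - T u‖ ≤ D * ‖u‖ ^ (1 + β) := hT V hV
    _ = D * ‖u‖ ^ β * ‖u‖ := by
      rw [Real.rpow_add_of_nonneg hu0 zero_le_one hβ0.le, Real.rpow_one]
      ring
    _ ≤ D * (2 * r ^ β) * ‖u‖ := by gcongr
  have hderiv : ‖(T - Amap) u‖ ≤ D * r ^ β * ‖u‖ :=
    (T - Amap).le_of_opNorm_le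
      (hTA.trans (by gcongr)) u
  have hRbound : ‖R‖ ≤ 3 * D * r ^ β * ‖u‖ := calc
    ‖R‖ = ‖(ψ V - ψ W - T u) + (T - Amap) u‖ := by
      rw [hR, sub_apply, sub_add_sub_cancel]
    _ ≤ D * (2 * r ^ β) * ‖u‖ + D * r ^ β * ‖u‖ := norm_add_le_of_le htaylor hderiv
    _ = 3 * D * r ^ β * ‖u‖ := by ring
  have hNR : NF (P R) ≤ (1 / ν - 1 / νh) * NE u := calc
    NF (P R) ≤ Γ * ‖R‖ := h2 R
    _ ≤ Γ * (3 * D * r ^ β * ‖u‖) := by gcongr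
    _ = 3 * Γ * D * r ^ β * ‖u‖ := by ring
    _ ≤ 3 * Γ * D * r ^ β * NE u := by
      gcongr
      exact h1 u
    _ ≤ (1 / ν - 1 / νh) * NE u :=
      mul_le_mul_of_nonneg_right h5 (hu0.trans (h1 u))
  have hsplit : Amap u = P (ψ V - ψ W) - P R := by
    rw [hR, map_sub P _ (Amap u), hPA, sub_sub_cancel]
  have htri : NF (Amap u) ≤ NF (P (ψ V - ψ W)) + NF (P R) := by
    rw [hsplit]
    exact map_sub_le_add NF _ _
  have hrates : (1 / ν - 1 / νh) * NE u = NE u / ν - NE u / νh := by ring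
  linarith
end
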